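/- arXiv:2006.13833 — 9 statements merged into one kernel-verified Lean document; each statement's English description precedes it below -/
import Mathlib

section
/- Let μ be the uniform probability measure on the interval (−1/2, 1/2] ⊆ ℝ and let y ∈ ℝ be arbitrary. Then the pushforward of μ under the map u ↦ round(y + u) − u equals the pushforward of μ under the map u ↦ y − u; that is, the random variables round(y + U) − U and y − U have the same distribution when U ∼ μ. -/
open MeasureTheory

/-- Shifting the window of a set of reals invariant under integer translations does not change
its measure. -/
theorem volume_inter_Ioc_eq_of_add_int_invariant {P : Set ℝ} (hP : MeasurableSet P)
    (hinv : ∀ (n : ℤ) (u : ℝ), (n : ℝ) + u ∈ P ↔ u ∈ P) (s t : ℝ) :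
    volume (P ∩ Set.Ioc s (s + 1)) = volume (P ∩ Set.Ioc t (t + 1)) := by
  refine (isAddFundamentalDomain_Ioc one_pos s).measure_set_eq
    (isAddFundamentalDomain_Ioc one_pos t) hP ?_
  rintro ⟨_, n, rfl⟩
  ext u
  simpa [AddSubgroup.vadd_def] using hinv n u

/-- **Crypto-Lemma for the integer lattice ℤ.**
If `μ` is the uniform probability measure on `(-1/2, 1/2]` (i.e. Lebesgue measure restricted to
that interval, which has total mass one), then for any `y : ℝ` the pushforward of `μ` under
`u ↦ round (y + u) - u` equals the pushforward of `μ` under `u ↦ y - u`. -/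
theorem crypto_lemma_Z (y : ℝ) :
    Measure.map (fun u : ℝ => ((round (y + u) : ℤ) : ℝ) - u)
      (volume.restrict (Set.Ioc (-(1/2) : ℝ) (1/2))) =
    Measure.map (fun u : ℝ => y - u)
      (volume.restrict (Set.Ioc (-(1/2) : ℝ) (1/2))) := by
  have hf : Measurable fun u : ℝ => ((round (y + u) : ℤ) : ℝ) - u := by
    simp only [round_eq]
    fun_prop
  have hg : Measurable fun u : ℝ => y - u := by fun_prop
  ext A hA
  rw [Measure.map_apply hf hA, Measure.map_apply hg hA, Measure.restrict_apply (hf hA),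
    Measure.restrict_apply (hg hA)]
  have hinv : ∀ (n : ℤ) (u : ℝ), (n : ℝ) + u ∈ (fun u : ℝ => ((round (y + u) : ℤ) : ℝ) - u) ⁻¹' A ↔
      u ∈ (fun u : ℝ => ((round (y + u) : ℤ) : ℝ) - u) ⁻¹' A := by
    intro n u
    have h : y + (n + u) = y + u + n := by ring
    simp only [Set.mem_preimage, h, round_add_intCast]
    push_cast
    ring_nf
  have hshift := volume_inter_Ioc_eq_of_add_int_invariant (hf hA) hinv (-(1/2)) (-(1/2) - y)
  rw [show (-(1/2) + 1 : ℝ) = 1/2 by norm_num] at hshift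
  rw [hshift, measure_congr ((ae_eq_refl _).inter Ico_ae_eq_Ioc.symm),
    measure_congr ((ae_eq_refl ((fun u : ℝ => y - u) ⁻¹' A)).inter Ico_ae_eq_Ioc.symm),
    ← measure_preimage_add_right volume y (_ ∩ Set.Ico (-(1/2) : ℝ) (1/2))]
  congr 1
  ext u
  simp only [Set.mem_inter_iff, Set.mem_preimage, Set.mem_Ico]
  have hIco : (-(1/2) - y ≤ u ∧ u < -(1/2) - y + 1) ↔ (-(1/2) ≤ u + y ∧ u + y < 1/2) := by
    constructor <;> rintro ⟨h₁, h₂⟩ <;> constructor <;> linarith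
  rw [hIco]
  refine and_congr_left fun h => ?_
  have hround : round (y + u) = 0 := by
    rw [round_eq, Int.floor_eq_zero_iff]
    constructor <;> linarith [h.1, h.2]
  rw [hround, show y - (u + y) = ((0 : ℤ) : ℝ) - u by push_cast; ring]
end

section
/- Let (Ω, P) be a probability space carrying independent real random variables S and U, where U is uniformly distributed on (−1/2, 1/2]. Then the random variable round(S + U) − U has the same distribution as S − U. -/
open MeasureTheory ProbabilityTheory

/-- The law of `s + u` reduced modulo `ℤ` to its nearest-integer remainder, for `u` uniform on the
fundamental cell, does not depend on the shift `s`. -/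
theorem setLIntegral_add_sub_round (s : ℝ) (f : ℝ → ENNReal) :
    ∫⁻ u in Set.Ioc (-(1/2) : ℝ) (1/2), f (s + u - round (s + u)) =
    ∫⁻ u in Set.Ioc (-(1/2) : ℝ) (1/2), f u := by
  have h_shift : ∫⁻ u in Set.Ioc (-(1/2) : ℝ) (1/2), f (s + u - round (s + u)) =
      ∫⁻ w in Set.Ioc (s - 1/2) (s - 1/2 + 1), f (w - round w) := by
    have h := (measurePreserving_add_left volume s).setLIntegral_comp_preimage_emb
      (measurableEmbedding_addLeft s) (fun w => f (w - round w))
      (Set.Ioc (s - 1/2) (s - 1/2 + 1))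
    rw [← h, Set.preimage_const_add_Ioc]
    ring_nf
  have h_period : ∫⁻ w in Set.Ioc (s - 1/2) (s - 1/2 + 1), f (w - round w) =
      ∫⁻ w in Set.Ioc (-(1/2) : ℝ) (-(1/2) + 1), f (w - round w) := by
    refine (isAddFundamentalDomain_Ioc one_pos _).setLIntegral_eq
      (isAddFundamentalDomain_Ioc one_pos _) _ ?_
    rintro ⟨_, n, rfl⟩ w
    simp [AddSubgroup.vadd_def, round_intCast_add]
  rw [h_shift, h_period, show -(1/2) + 1 = (1/2 : ℝ) by norm_num,
    setLIntegral_congr Ioo_ae_eq_Ioc.symm, setLIntegral_congr Ioo_ae_eq_Ioc.symm]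
  refine setLIntegral_congr_fun measurableSet_Ioo fun w hw => ?_
  have h_round : round w = 0 := round_eq_zero_iff.2 ⟨by linarith [hw.1], hw.2⟩
  simp [h_round]

/-- **Randomized Crypto-Lemma for ℤ.**
Let `(Ω, P)` be a probability space carrying independent real random variables `S` and `U`,
with `U` uniformly distributed on `(-1/2, 1/2]`. Then `round (S + U) - U` has the same
distribution as `S - U`. -/
theorem crypto_lemma_random (Ω : Type*) [MeasurableSpace Ω] (P : Measure Ω)
    [IsProbabilityMeasure P] (S U : Ω → ℝ) (hS : Measurable S) (hU : Measurable U)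
    (hindep : IndepFun S U P)
    (hUnif : Measure.map U P = volume.restrict (Set.Ioc (-(1/2) : ℝ) (1/2))) :
    Measure.map (fun ω => ((round (S ω + U ω) : ℤ) : ℝ) - U ω) P =
    Measure.map (fun ω => S ω - U ω) P := by
  have h_law := (indepFun_iff_map_prod_eq_prod_map_map hS.aemeasurable hU.aemeasurable).1 hindep
  rw [hUnif] at h_law
  have h_round : Measurable fun p : ℝ × ℝ => ((round (p.1 + p.2) : ℤ) : ℝ) - p.2 := by
    simp only [round_eq]
    fun_prop
  have h_sub : Measurable fun p : ℝ × ℝ => p.1 - p.2 := by fun_prop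
  have h_pair := hS.prodMk hU
  refine (Measure.map_map h_round h_pair).symm.trans (Eq.trans ?_ (Measure.map_map h_sub h_pair))
  rw [h_law]
  refine Measure.ext_of_lintegral _ fun f hf => ?_
  rw [lintegral_map hf h_round, lintegral_map hf h_sub,
    lintegral_prod _ (by exact (hf.comp h_round).aemeasurable),
    lintegral_prod _ (by exact (hf.comp h_sub).aemeasurable)]
  refine lintegral_congr fun s => ?_
  have h_sub_remainder (u : ℝ) : s - (s + u - round (s + u)) = round (s + u) - u := by ring
  simpa only [h_sub_remainder] using setLIntegral_add_sub_round s fun w => f (s - w)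
end

section
/- Let y ∈ ℝ and let g : ℝ → [0, ∞] be measurable. Then ∫_{(−1/2, 1/2]} g(round(y + u) − u) du = ∫_{(−1/2, 1/2]} g(y − u) du, where the integrals are taken with respect to Lebesgue measure and valued in [0, ∞]. -/
open MeasureTheory

/-- The Lebesgue integral of a periodic `[0, ∞]`-valued function over a period does not depend on
the endpoint of the period. -/
lemma Function.Periodic.setLIntegral_Ioc_add_eq {f : ℝ → ENNReal} {T : ℝ}
    (hf : Function.Periodic f T) (hT : 0 < T) (t s : ℝ) :
    ∫⁻ u in Set.Ioc t (t + T), f u = ∫⁻ u in Set.Ioc s (s + T), f u :=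
  (isAddFundamentalDomain_Ioc hT t).setLIntegral_eq (isAddFundamentalDomain_Ioc hT s) f
    hf.map_vadd_zmultiples

lemma periodic_comp_round_add_sub {α : Type*} (g : ℝ → α) (y : ℝ) :
    Function.Periodic (fun u : ℝ => g (((round (y + u) : ℤ) : ℝ) - u)) 1 := by
  intro u
  simp only [← add_assoc, round_add_one, Int.cast_add, Int.cast_one, add_sub_add_right_eq_sub]

/-- **Reconstruction-cost equality for the integer lattice.**
For any `y : ℝ` and any measurable `g : ℝ → [0, ∞]`,
`∫_{(-1/2,1/2]} g (round (y+u) - u) du = ∫_{(-1/2,1/2]} g (y - u) du`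
with respect to Lebesgue measure, the integrals valued in `[0, ∞]`. -/
theorem reconstruction_cost_eq (y : ℝ) (g : ℝ → ENNReal) (hg : Measurable g) :
    ∫⁻ u in Set.Ioc (-(1/2) : ℝ) (1/2), g (((round (y + u) : ℤ) : ℝ) - u) =
    ∫⁻ u in Set.Ioc (-(1/2) : ℝ) (1/2), g (y - u) := by
  set f : ℝ → ENNReal := fun u => g (((round (y + u) : ℤ) : ℝ) - u) with hf
  calc ∫⁻ u in Set.Ioc (-(1/2) : ℝ) (1/2), f u
      = ∫⁻ u in Set.Ioc (-(1/2) - y : ℝ) (1/2 - y), f u := by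
        convert (periodic_comp_round_add_sub g y).setLIntegral_Ioc_add_eq one_pos
          (-(1/2)) (-(1/2) - y) using 4 <;> ring
    _ = ∫⁻ u in Set.Ioo (-(1/2) - y : ℝ) (1/2 - y), f u :=
        setLIntegral_congr Ioo_ae_eq_Ioc.symm
    _ = ∫⁻ u in Set.Ioo (-(1/2) - y : ℝ) (1/2 - y), g (-u) := by
        refine setLIntegral_congr_fun measurableSet_Ioo fun u hu => ?_
        have h : round (y + u) = 0 :=
          round_eq_zero_iff.2 ⟨by linarith [hu.1], by linarith [hu.2]⟩
        simp [hf, h]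
    _ = ∫⁻ u in Set.Ioc (-(1/2) - y : ℝ) (1/2 - y), g (-u) :=
        setLIntegral_congr Ioo_ae_eq_Ioc
    _ = ∫⁻ u in Set.Ioc (-(1/2) : ℝ) (1/2), g (y - u) := by
        rw [← (measurePreserving_sub_right volume y).setLIntegral_comp_preimage
          measurableSet_Ioc (by fun_prop)]
        simp
end

section
/- Let (Ω, P) be a probability space and let S, U, Z : Ω → ℤ^d be random variables such that: (i) S and U are independent; (ii) S and U are conditionally independent given Z − U, in the sense that for all s, u, w ∈ ℤ^d, P[S = s ∧ U = u ∧ Z − U = w] · P[Z − U = w] = P[S = s ∧ Z − U = w] · P[U = u ∧ Z − U = w]; and (iii) for given s, u, z ∈ ℤ^d one has P[Z = z ∧ U = u] > 0, P[S = s ∧ U = u] > 0, P[S = s] > 0 and P[Z − U = z − u] > 0. Then (P[Z = z ∧ S = s ∧ U = u] / P[S = s ∧ U = u]) / (P[Z = z ∧ U = u] / P[U = u]) = (P[Z − U = z − u ∧ S = s] / P[S = s]) / P[Z − U = z − u]. -/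
open MeasureTheory ProbabilityTheory

theorem ENNReal.div_mul_div_div_eq_of_mul_eq {a b c e f w : ENNReal} (ha : a ≠ ⊤) (hb : b ≠ ⊤)
    (hc : c ≠ ⊤) (he : e ≠ ⊤) (hf : f ≠ ⊤) (hw : w ≠ ⊤) (hb0 : b ≠ 0) (hc0 : c ≠ 0) (he0 : e ≠ 0)
    (hw0 : w ≠ 0) (h : a * w = f * e) : a / (b * c) / (e / c) = f / b / w := by
  lift a to NNReal using ha
  lift b to NNReal using hb
  lift c to NNReal using hc
  lift e to NNReal using he
  lift f to NNReal using hf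
  lift w to NNReal using hw
  norm_cast at *
  have hec : e / c ≠ 0 := div_ne_zero he0 hc0
  have hbc : b * c ≠ 0 := mul_ne_zero hb0 hc0
  rw [← ENNReal.coe_div hbc, ← ENNReal.coe_div hc0, ← ENNReal.coe_div hec,
    ← ENNReal.coe_div hb0, ← ENNReal.coe_div hw0, ENNReal.coe_inj]
  field_simp
  rw [h, mul_comm]

/-- **Discrete version of the paper's Lemma 2.**
Let `S, U, Z : Ω → ℤ^d` with `S` and `U` independent and `S` and `U` conditionally independent
given `Z - U` (stated pointwise), and suppose the relevant events have positive probability.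
Then the ratio of `P(Z = z | S = s, U = u)` to `P(Z = z | U = u)` equals the ratio of
`P(Z - U = z - u | S = s)` to `P(Z - U = z - u)`. -/
theorem discrete_lemma2 (Ω : Type*) [MeasurableSpace Ω] (P : Measure Ω)
    [IsProbabilityMeasure P] (d : ℕ) (S U Z : Ω → Fin d → ℤ)
    (hindep : IndepFun S U P)
    (hcondindep : ∀ s u w : Fin d → ℤ,
      P {ω | S ω = s ∧ U ω = u ∧ Z ω - U ω = w} * P {ω | Z ω - U ω = w} =
        P {ω | S ω = s ∧ Z ω - U ω = w} * P {ω | U ω = u ∧ Z ω - U ω = w})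
    (s u z : Fin d → ℤ)
    (hZU : 0 < P {ω | Z ω = z ∧ U ω = u})
    (hSU : 0 < P {ω | S ω = s ∧ U ω = u})
    (hS : 0 < P {ω | S ω = s})
    (hW : 0 < P {ω | Z ω - U ω = z - u}) :
    (P {ω | Z ω = z ∧ S ω = s ∧ U ω = u} / P {ω | S ω = s ∧ U ω = u}) /
      (P {ω | Z ω = z ∧ U ω = u} / P {ω | U ω = u}) =
    (P {ω | Z ω - U ω = z - u ∧ S ω = s} / P {ω | S ω = s}) /
      P {ω | Z ω - U ω = z - u} := by
  have hprod : P {ω | S ω = s ∧ U ω = u} = P {ω | S ω = s} * P {ω | U ω = u} :=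
    hindep.measure_inter_preimage_eq_mul {s} {u} (measurableSet_singleton s)
      (measurableSet_singleton u)
  have hZ : ∀ ω, U ω = u → (Z ω - U ω = z - u ↔ Z ω = z) := by
    rintro ω rfl
    exact sub_left_inj
  have hSZU : {ω | S ω = s ∧ U ω = u ∧ Z ω - U ω = z - u} =
      {ω | Z ω = z ∧ S ω = s ∧ U ω = u} := by
    ext ω
    have := hZ ω
    simp only [Set.mem_ofPred_eq]
    tauto
  have hUZ : {ω | U ω = u ∧ Z ω - U ω = z - u} = {ω | Z ω = z ∧ U ω = u} := by
    ext ω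
    have := hZ ω
    simp only [Set.mem_ofPred_eq]
    tauto
  have hcond := hcondindep s u (z - u)
  simp only [hSZU, hUZ, and_comm (a := S _ = s) (b := Z _ - U _ = z - u)] at hcond
  have hU : P {ω | U ω = u} ≠ 0 := right_ne_zero_of_mul (hprod ▸ hSU.ne')
  rw [hprod]
  exact ENNReal.div_mul_div_div_eq_of_mul_eq (measure_ne_top _ _) (measure_ne_top _ _)
    (measure_ne_top _ _) (measure_ne_top _ _) (measure_ne_top _ _) (measure_ne_top _ _)
    hS.ne' hU hZU.ne' hW.ne' hcond
end

section
/- Let (Ω, F, P) be a standard Borel probability space carrying independent real random variables S and U, with U uniformly distributed on (−1/2, 1/2], and define Z := round(S + U). Then U = round(Z − U) − (Z − U) holds everywhere on the event {U ∈ (−1/2, 1/2]} (in particular almost surely), and consequently S and U are conditionally independent given the σ-algebra generated by Z − U. -/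
open MeasureTheory ProbabilityTheory

/-- Rounding to the nearest integer (ties up) is measurable. -/
theorem measurable_round_real : Measurable (round : ℝ → ℤ) := by
  have h : (round : ℝ → ℤ) = fun x => ⌊x + 1 / 2⌋ := funext fun x => round_eq x
  rw [h]
  exact Int.measurable_floor.comp (measurable_id.add_const _)

theorem round_intCast_sub_of_mem_Ioc (n : ℤ) {u : ℝ} (hu : u ∈ Set.Ioc (-(1/2) : ℝ) (1/2)) :
    round ((n : ℝ) - u) = n := by
  rw [round_eq, Int.floor_eq_iff]
  constructor <;> linarith [hu.1, hu.2]

/-- Conditional independence holds when the second variable is almost surely equal to one that is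
measurable with respect to the conditioning σ-algebra. -/
theorem condIndepFun_of_ae_eq_measurable_right {Ω β β' : Type*} {m' mΩ : MeasurableSpace Ω}
    [StandardBorelSpace Ω] (hm' : m' ≤ mΩ) {μ : Measure Ω} [IsFiniteMeasure μ]
    {mβ : MeasurableSpace β} {mβ' : MeasurableSpace β'} {X : Ω → β} {Y Y' : Ω → β'}
    (hX : Measurable X) (hY' : Measurable[m'] Y') (h : Y' =ᵐ[μ] Y) :
    CondIndepFun m' hm' X Y μ := by
  rw [← condExpKernel_comp_trim (μ := μ) hm'] at h
  exact Kernel.IndepFun.congr' (condIndepFun_of_measurable_right hX hY')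
    (ae_of_all _ fun _ => Filter.EventuallyEq.rfl) (Measure.ae_ae_of_ae_comp h)

/-- **Key step in the proof of the paper's Theorem 1.**
On a standard Borel probability space carrying independent real random variables `S` and `U`,
with `U` uniform on `(-1/2, 1/2]`, set `Z := round (S + U)`. Then
`U = round (Z - U) - (Z - U)` on the event `{U ∈ (-1/2, 1/2]}` (hence almost surely), and
consequently `S` and `U` are conditionally independent given the σ-algebra generated by
`Z - U`. -/
theorem dither_recoverable_and_condIndep (Ω : Type*) [MeasurableSpace Ω]
    [StandardBorelSpace Ω] (P : Measure Ω) [IsProbabilityMeasure P]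
    (S U : Ω → ℝ) (hS : Measurable S) (hU : Measurable U)
    (hindep : IndepFun S U P)
    (hUnif : Measure.map U P = volume.restrict (Set.Ioc (-(1/2) : ℝ) (1/2))) :
    (∀ ω, U ω ∈ Set.Ioc (-(1/2) : ℝ) (1/2) →
      U ω =
        ((round (((round (S ω + U ω) : ℤ) : ℝ) - U ω) : ℤ) : ℝ) -
          (((round (S ω + U ω) : ℤ) : ℝ) - U ω)) ∧
    CondIndepFun
      (MeasurableSpace.comap (fun ω => ((round (S ω + U ω) : ℤ) : ℝ) - U ω) inferInstance)
      (Measurable.comap_le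
        ((measurable_from_top.comp (measurable_round_real.comp (hS.add hU))).sub hU))
      S U P := by
  have hrec : ∀ ω, U ω ∈ Set.Ioc (-(1/2) : ℝ) (1/2) →
      U ω =
        ((round (((round (S ω + U ω) : ℤ) : ℝ) - U ω) : ℤ) : ℝ) -
          (((round (S ω + U ω) : ℤ) : ℝ) - U ω) := by
    intro ω hω
    rw [round_intCast_sub_of_mem_Ioc _ hω, sub_sub_cancel]
  have hmem : ∀ᵐ ω ∂P, U ω ∈ Set.Ioc (-(1/2) : ℝ) (1/2) := by
    refine ae_of_ae_map hU.aemeasurable ?_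
    rw [hUnif]
    exact ae_restrict_mem measurableSet_Ioc
  have hg : Measurable fun x : ℝ => ((round x : ℤ) : ℝ) - x :=
    (measurable_from_top.comp measurable_round_real).sub measurable_id
  exact ⟨hrec, condIndepFun_of_ae_eq_measurable_right _ hS
    (hg.comp (comap_measurable _)) (hmem.mono fun ω hω => (hrec ω hω).symm)⟩
end

section
/- Let ν be a Borel probability measure on ℝ (the law of S), let y ∈ ℝ, and let μ be the uniform probability measure on (−1/2, 1/2]. Then ∫ −log ν([round(y+u) − u − 1/2, round(y+u) − u + 1/2)) dμ(u) = ∫ −log ν([y − u − 1/2, y − u + 1/2)) dμ(u), where both integrals are taken in [0, ∞] (the integrands are nonnegative since ν of any interval is at most 1). -/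
open MeasureTheory

/-- `negLog x` is `-log x` as an element of `[0, ∞]`, for `x ∈ [0, 1]`:
it equals `∞` when `x = 0` and `-Real.log x` (a nonnegative real) when `0 < x ≤ 1`. -/
noncomputable def negLog (x : ENNReal) : ENNReal :=
  if x = 0 then ⊤ else ENNReal.ofReal (-Real.log x.toReal)

open Set

/-- The lower integral of a periodic function over a period does not depend on the period chosen.
No measurability is needed. -/
theorem Function.Periodic.setLIntegral_Ioc_eq {f : ℝ → ENNReal} {T : ℝ}
    (hf : Function.Periodic f T) (hT : 0 < T) (a b : ℝ) :
    ∫⁻ x in Ioc a (a + T), f x = ∫⁻ x in Ioc b (b + T), f x := by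
  have : VAddInvariantMeasure (AddSubgroup.zmultiples T) ℝ volume :=
    ⟨fun c s _ => measure_preimage_add _ _ _⟩
  exact (isAddFundamentalDomain_Ioc hT a).setLIntegral_eq (isAddFundamentalDomain_Ioc hT b) f
    hf.map_vadd_zmultiples

/-- **The paper's Theorem 1 for the integer lattice ℤ.**
Let `ν` be a Borel probability measure on `ℝ` (the law of `S`), `y ∈ ℝ`, and let `μ` be the
uniform probability measure on `(-1/2, 1/2]` (Lebesgue measure restricted to it). Then the
expected representation cost `E_U[-log ν([round(y+U) - U - 1/2, round(y+U) - U + 1/2))]`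
equals `E_U[-log ν([y - U - 1/2, y - U + 1/2))]`, both valued in `[0, ∞]`. -/
theorem representation_cost_eq_Z (ν : Measure ℝ) [IsProbabilityMeasure ν] (y : ℝ) :
    ∫⁻ u in Set.Ioc (-(1/2) : ℝ) (1/2),
        negLog (ν (Set.Ico ((((round (y + u) : ℤ) : ℝ) - u) - 1/2)
          ((((round (y + u) : ℤ) : ℝ) - u) + 1/2))) =
    ∫⁻ u in Set.Ioc (-(1/2) : ℝ) (1/2),
        negLog (ν (Set.Ico ((y - u) - 1/2) ((y - u) + 1/2))) := by
  let F : ℝ → ENNReal := fun t => negLog (ν (Ico (t - 1/2) (t + 1/2)))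
  let G : ℝ → ENNReal := fun v => F (round v - v + y)
  have hG : Function.Periodic G 1 := fun v => by
    simp only [G, round_add_one, Int.cast_add, Int.cast_one, add_sub_add_right_eq_sub]
  calc ∫⁻ u in Ioc (-(1/2) : ℝ) (1/2), F (round (y + u) - u)
      = ∫⁻ u in Ioc (-(1/2) : ℝ) (1/2), G (y + u) := by
        refine lintegral_congr fun u => congrArg F ?_
        ring
    _ = ∫⁻ v in Ioc (y - 1/2) (y - 1/2 + 1), G v := by
        have h : Ioc (-(1/2) : ℝ) (1/2) = (y + ·) ⁻¹' Ioc (y - 1/2) (y - 1/2 + 1) := by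
          rw [preimage_const_add_Ioc]
          congr 1 <;> ring
        rw [h]
        exact (measurePreserving_add_left volume y).setLIntegral_comp_preimage_emb
          (measurableEmbedding_addLeft y) G _
    _ = ∫⁻ v in Ioc (-(1/2)) (-(1/2) + 1), G v := hG.setLIntegral_Ioc_eq one_pos _ _
    _ = ∫⁻ v in Ioo (-(1/2)) (1/2), G v := by
        rw [← setLIntegral_congr Ioo_ae_eq_Ioc]
        norm_num
    _ = ∫⁻ v in Ioo (-(1/2)) (1/2), F (y - v) := by
        refine setLIntegral_congr_fun measurableSet_Ioo fun v hv => ?_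
        have h : round v = 0 := round_eq_zero_iff.2 (Ioo_subset_Ico_self hv)
        simp only [G, h, Int.cast_zero]
        congr 1
        ring
    _ = ∫⁻ u in Ioc (-(1/2) : ℝ) (1/2), F (y - u) := setLIntegral_congr Ioo_ae_eq_Ioc
end

section
/- Let m ≥ 1, let ν be a Borel probability measure on ℝ^m (the law of S), let y ∈ ℝ^m, and let μ be the uniform probability measure on (−1/2, 1/2]^m. Let K : ℝ^m → ℝ^m apply round coordinatewise. Then ∫ −log ν(∏ᵢ [K(y+u)ᵢ − uᵢ − 1/2, K(y+u)ᵢ − uᵢ + 1/2)) dμ(u) = ∫ −log ν(∏ᵢ [yᵢ − uᵢ − 1/2, yᵢ − uᵢ + 1/2)) dμ(u), where both integrals are taken in [0, ∞]. -/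
open MeasureTheory

/-- The integer lattice `ℤ^m` in `ℝ^m`, as an additive subgroup. -/
def integerLattice (m : ℕ) : AddSubgroup (Fin m → ℝ) :=
  ((Int.castAddHom ℝ).compLeft (Fin m)).range

instance (m : ℕ) : Countable (integerLattice m) :=
  (Set.countable_range ((Int.castAddHom ℝ).compLeft (Fin m))).to_subtype

theorem mem_integerLattice {m : ℕ} {x : Fin m → ℝ} :
    x ∈ integerLattice m ↔ ∃ n : Fin m → ℤ, (fun i => (n i : ℝ)) = x :=
  Iff.rfl

theorem isAddFundamentalDomain_pi_Ico {m : ℕ} (a : Fin m → ℝ) :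
    IsAddFundamentalDomain (integerLattice m)
      (Set.univ.pi fun i => Set.Ico (a i) (a i + 1)) volume := by
  refine IsAddFundamentalDomain.mk'
    (MeasurableSet.univ_pi fun i => measurableSet_Ico).nullMeasurableSet fun x => ?_
  choose n hn hu using fun i => existsUnique_add_zsmul_mem_Ico (zero_lt_one' ℝ) (x i) (a i)
  refine ⟨⟨fun i => n i, mem_integerLattice.2 ⟨n, rfl⟩⟩, fun i _ => ?_, ?_⟩
  · simpa [AddSubgroup.vadd_def, add_comm] using hn i
  · rintro ⟨g, hg⟩ h
    obtain ⟨k, rfl⟩ := mem_integerLattice.1 hg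
    ext i
    have := hu i (k i) (by simpa [AddSubgroup.vadd_def, add_comm] using h i trivial)
    simp [this]

/-- The rounding error of a uniformly dithered point is, up to sign, again uniform on the cube. -/
theorem setLIntegral_round_sub {m : ℕ} (y : Fin m → ℝ) (f : (Fin m → ℝ) → ENNReal) :
    ∫⁻ u in (Set.univ.pi fun _ : Fin m => Set.Ico (-(1/2) : ℝ) (1/2)),
        f (fun i => (round (y i + u i) : ℝ) - (y i + u i)) =
      ∫⁻ u in (Set.univ.pi fun _ : Fin m => Set.Ico (-(1/2) : ℝ) (1/2)), f (-u) := by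
  set s := Set.univ.pi fun _ : Fin m => Set.Ico (-(1/2) : ℝ) (1/2) with hs
  set t := Set.univ.pi fun i : Fin m => Set.Ico (y i - 1/2) (y i - 1/2 + 1) with ht
  let g : (Fin m → ℝ) → ENNReal := fun v => f fun i => (round (v i) : ℝ) - v i
  have hpre : (y + ·) ⁻¹' t = s := by
    ext u
    simp only [hs, ht, Set.mem_preimage, Set.mem_univ_pi, Set.mem_Ico, Pi.add_apply]
    refine forall_congr' fun i => and_congr ?_ ?_ <;> constructor <;> intro h <;> linarith
  have hfd : IsAddFundamentalDomain (integerLattice m) s volume := by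
    convert isAddFundamentalDomain_pi_Ico fun _ : Fin m => (-(1/2) : ℝ) using 4
    norm_num
  calc
    _ = ∫⁻ u in (y + ·) ⁻¹' t, g (y + u) := by rw [hpre]; rfl
    _ = ∫⁻ v in t, g v :=
      (measurePreserving_add_left volume y).setLIntegral_comp_preimage_emb
        (MeasurableEquiv.addLeft y).measurableEmbedding g t
    _ = ∫⁻ v in s, g v := by
      refine (isAddFundamentalDomain_pi_Ico fun i => y i - 1/2).setLIntegral_eq hfd g ?_
      rintro ⟨_, hk⟩ x
      obtain ⟨k, rfl⟩ := mem_integerLattice.1 hk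
      simp [g, AddSubgroup.vadd_def]
    _ = _ := by
      refine setLIntegral_congr_fun (MeasurableSet.univ_pi fun _ => measurableSet_Ico)
        fun u hu => ?_
      have hr (i : Fin m) : round (u i) = 0 := round_eq_zero_iff.2 (by simpa using hu i trivial)
      simp only [g, hr, Int.cast_zero, zero_sub]
      rfl

/-- **The paper's Theorem 1 for the lattice ℤ^m.**
Let `ν` be a Borel probability measure on `ℝ^m` (the law of `S`), `y ∈ ℝ^m`, and let `μ` be
the uniform probability measure on the cube `(-1/2, 1/2]^m`. With `K` the coordinatewise
rounding map, the expected representation cost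
`E_U[-log ν(∏ᵢ [K(y+U)ᵢ - Uᵢ - 1/2, K(y+U)ᵢ - Uᵢ + 1/2))]` equals
`E_U[-log ν(∏ᵢ [yᵢ - Uᵢ - 1/2, yᵢ - Uᵢ + 1/2))]`, both valued in `[0, ∞]`. -/
theorem representation_cost_eq_Zm (m : ℕ) (hm : 1 ≤ m)
    (ν : Measure (Fin m → ℝ)) [IsProbabilityMeasure ν] (y : Fin m → ℝ) :
    ∫⁻ u in (Set.univ.pi fun _ : Fin m => Set.Ioc (-(1/2) : ℝ) (1/2)),
        negLog (ν (Set.univ.pi fun i =>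
          Set.Ico ((((round (y i + u i) : ℤ) : ℝ) - u i) - 1/2)
            ((((round (y i + u i) : ℤ) : ℝ) - u i) + 1/2))) =
    ∫⁻ u in (Set.univ.pi fun _ : Fin m => Set.Ioc (-(1/2) : ℝ) (1/2)),
        negLog (ν (Set.univ.pi fun i =>
          Set.Ico ((y i - u i) - 1/2) ((y i - u i) + 1/2))) := by
  have hae : (Set.univ.pi fun _ : Fin m => Set.Ioc (-(1/2) : ℝ) (1/2)) =ᵐ[volume]
      Set.univ.pi fun _ : Fin m => Set.Ico (-(1/2) : ℝ) (1/2) :=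
    Measure.univ_pi_Ioc_ae_eq_Icc.trans Measure.univ_pi_Ico_ae_eq_Icc.symm
  rw [setLIntegral_congr hae, setLIntegral_congr hae]
  convert setLIntegral_round_sub y fun w => negLog (ν (Set.univ.pi fun i =>
    Set.Ico ((y i + w i) - 1/2) ((y i + w i) + 1/2))) using 8 with u i
  all_goals simp; try ring
end

section
/- Let B₁, …, B₈ be the rows of the matrix with rows (2,0,0,0,0,0,0,0), (−1,1,0,0,0,0,0,0), (0,−1,1,0,0,0,0,0), (0,0,−1,1,0,0,0,0), (0,0,0,−1,1,0,0,0), (0,0,0,0,−1,1,0,0), (0,0,0,0,0,−1,1,0), (1/2,1/2,1/2,1/2,1/2,1/2,1/2,1/2). Define E₈ := { x : Fin 8 → ℝ | ( (∀ i, ∃ n : ℤ, x i = n) ∨ (∀ i, ∃ n : ℤ, x i = n + 1/2) ) ∧ (∃ k : ℤ, ∑ i, x i = 2·k) }. Then the set of all integer linear combinations { ∑ⱼ cⱼ • Bⱼ : c ∈ ℤ⁸ } equals E₈. -/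
/-- The E₈ lattice: vectors of `ℝ⁸` whose coordinates are all integers or all half-integers,
with even coordinate sum. -/
def E8 : Set (Fin 8 → ℝ) :=
  { x | ((∀ i, ∃ n : ℤ, x i = n) ∨ (∀ i, ∃ n : ℤ, x i = n + 1/2)) ∧
        (∃ k : ℤ, ∑ i, x i = 2 * k) }

/-- The basis matrix of the E₈ lattice given in the paper; `E8basis j` is its `j`-th row. -/
noncomputable def E8basis : Fin 8 → Fin 8 → ℝ :=
  ![![2, 0, 0, 0, 0, 0, 0, 0],
    ![-1, 1, 0, 0, 0, 0, 0, 0],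
    ![0, -1, 1, 0, 0, 0, 0, 0],
    ![0, 0, -1, 1, 0, 0, 0, 0],
    ![0, 0, 0, -1, 1, 0, 0, 0],
    ![0, 0, 0, 0, -1, 1, 0, 0],
    ![0, 0, 0, 0, 0, -1, 1, 0],
    ![1/2, 1/2, 1/2, 1/2, 1/2, 1/2, 1/2, 1/2]]

/-- The coordinates of an integer combination of the rows of `E8basis`. -/
theorem sum_smul_E8basis (c : Fin 8 → ℤ) :
    ∑ j, c j • E8basis j =
      (![2 * c 0 - c 1 + c 7 / 2, c 1 - c 2 + c 7 / 2, c 2 - c 3 + c 7 / 2,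
        c 3 - c 4 + c 7 / 2, c 4 - c 5 + c 7 / 2, c 5 - c 6 + c 7 / 2,
        c 6 + c 7 / 2, c 7 / 2] : Fin 8 → ℝ) := by
  ext i
  fin_cases i <;> simp [E8basis, Fin.sum_univ_eight] <;> ring

/-- Every vector of `E8` differs from a half-integral multiple of the all-ones vector by an integral
vector; the shift can be taken to be the last coordinate. -/
theorem exists_int_shift_of_mem_E8 {x : Fin 8 → ℝ} (hx : x ∈ E8) :
    ∃ (p : ℤ) (m : Fin 8 → ℤ), m 7 = 0 ∧ ∀ i, x i = m i + p / 2 := by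
  rcases hx.1 with h | h <;> choose n hn using h
  · refine ⟨2 * n 7, fun i => n i - n 7, sub_self _, fun i => ?_⟩
    rw [hn i]
    push_cast
    ring
  · refine ⟨2 * n 7 + 1, fun i => n i - n 7, sub_self _, fun i => ?_⟩
    rw [hn i]
    push_cast
    ring

/-- **The ℤ-span of the rows of the paper's basis matrix is exactly the E₈ lattice.** -/
theorem E8_span_basis :
    { x : Fin 8 → ℝ | ∃ c : Fin 8 → ℤ, x = ∑ j, c j • E8basis j } = E8 := by
  ext x
  constructor
  · rintro ⟨c, rfl⟩
    rw [sum_smul_E8basis]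
    let m : Fin 8 → ℤ := ![2 * c 0 - c 1, c 1 - c 2, c 2 - c 3, c 3 - c 4, c 4 - c 5,
      c 5 - c 6, c 6, 0]
    refine ⟨?_, c 0 + 2 * c 7, ?_⟩
    · rcases Int.even_or_odd' (c 7) with ⟨q, hq | hq⟩
      · refine Or.inl fun i => ⟨m i + q, ?_⟩
        fin_cases i <;> simp [m, hq]
      · refine Or.inr fun i => ⟨m i + q, ?_⟩
        fin_cases i <;> simp [m, hq] <;> ring
    · simp [Fin.sum_univ_eight]
      ring
  · intro hx
    obtain ⟨p, m, hm, hxm⟩ := exists_int_shift_of_mem_E8 hx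
    obtain ⟨k, hk⟩ := hx.2
    have hsum : m 0 + m 1 + m 2 + m 3 + m 4 + m 5 + m 6 = 2 * (k - 2 * p) := by
      simp only [Fin.sum_univ_eight, hxm, hm] at hk
      push_cast at hk
      have : (m 0 + m 1 + m 2 + m 3 + m 4 + m 5 + m 6 : ℝ) = 2 * (k - 2 * p) := by linarith
      exact_mod_cast this
    have hm0 : m 0 = 2 * (k - 2 * p) - (m 1 + m 2 + m 3 + m 4 + m 5 + m 6) := by linarith
    refine ⟨![k - 2 * p, m 1 + m 2 + m 3 + m 4 + m 5 + m 6, m 2 + m 3 + m 4 + m 5 + m 6,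
      m 3 + m 4 + m 5 + m 6, m 4 + m 5 + m 6, m 5 + m 6, m 6, p], ?_⟩
    rw [sum_smul_E8basis]
    ext i
    rw [hxm i]
    fin_cases i <;> simp [hm, hm0]
end

section
/- Define D₈ := { z : Fin 8 → ℤ | ∃ k : ℤ, ∑ i, z i = 2·k }, and for x : Fin 8 → ℝ let r(x) be the coordinatewise rounding, r(x)ᵢ = round(xᵢ), and let d_max := max over i of |xᵢ − r(x)ᵢ|. If ∑ i, r(x)ᵢ is odd, then the minimum over z ∈ D₈ of ∑ i (xᵢ − zᵢ)² exists and equals ∑ i (xᵢ − r(x)ᵢ)² + 1 − 2·d_max; moreover the minimum is attained by a vector obtained from r(x) by changing a single coordinate j attaining d_max to the other integer nearest to x_j. -/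
/-- The checkerboard lattice D₈ of integer vectors in ℝ⁸ with even coordinate sum. -/
def D8 : Set (Fin 8 → ℤ) := { z | ∃ k : ℤ, ∑ i, z i = 2 * k }

/-- An integer other than `round y` is at least as far from `y` as the second nearest integer. -/
theorem sq_sub_round_add_le {y : ℝ} {n : ℤ} (hn : n ≠ round y) :
    (y - round y) ^ 2 + (1 - 2 * |y - round y|) ≤ (y - n) ^ 2 := by
  have he := abs_sub_round y
  have hm : (1 : ℝ) ≤ |(n : ℝ) - round y| := by
    exact_mod_cast Int.one_le_abs (sub_ne_zero.mpr hn)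
  have hmul : (y - round y) * ((n : ℝ) - round y) ≤ |y - round y| * |(n : ℝ) - round y| := by
    rw [← abs_mul]
    exact le_abs_self _
  nlinarith [sq_abs ((n : ℝ) - round y), mul_nonneg (sub_nonneg.mpr hm)
    (by linarith : 0 ≤ |(n : ℝ) - round y| + 1 - 2 * |y - round y|)]

/-- Rounding `y` the wrong way raises the squared error by `1 - 2 * |y - round y|`. -/
theorem sq_sub_wrong_round (y : ℝ) :
    (y - ((if (round y : ℝ) ≤ y then round y + 1 else round y - 1 : ℤ) : ℝ)) ^ 2 =
      (y - round y) ^ 2 + (1 - 2 * |y - round y|) := by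
  split_ifs with hy
  · rw [abs_of_nonneg (sub_nonneg.mpr hy)]
    push_cast
    ring
  · rw [abs_of_neg (sub_neg.mpr (not_le.mp hy))]
    push_cast
    ring

/-- Changing one argument of a sum changes only the corresponding summand. -/
theorem Fintype.sum_apply_update {ι α M : Type*} [Fintype ι] [DecidableEq ι] [AddCommGroup M]
    (f : ι → α → M) (g : ι → α) (j : ι) (a : α) :
    ∑ i, f i (Function.update g j a i) = ∑ i, f i (g i) + (f j a - f j (g j)) := by
  rw [← Finset.add_sum_erase _ _ (Finset.mem_univ j),
    ← Finset.add_sum_erase _ (fun i => f i (g i)) (Finset.mem_univ j),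
    Finset.sum_congr rfl fun i hi => by
      rw [Function.update_of_ne (Finset.ne_of_mem_erase hi)]]
  simp only [Function.update_self]
  abel

/-- **Second case of the fast nearest-neighbor algorithm for D₈** (paper's appendix):
if coordinatewise rounding of `x` has odd coordinate sum, then the minimum over `z ∈ D₈` of
`∑ᵢ (xᵢ - zᵢ)²` exists and equals `∑ᵢ (xᵢ - round(xᵢ))² + 1 - 2·d_max`, where `d_max` is the
largest coordinatewise rounding error; moreover it is attained by changing a single coordinate
`j` attaining `d_max` to the other integer nearest to `x j`. -/
theorem D8_round_odd_nearest (x : Fin 8 → ℝ)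
    (h : ¬ ∃ k : ℤ, ∑ i, round (x i) = 2 * k) :
    IsLeast { v : ℝ | ∃ z ∈ D8, v = ∑ i, (x i - ((z i : ℤ) : ℝ)) ^ 2 }
      (∑ i, (x i - ((round (x i) : ℤ) : ℝ)) ^ 2 + 1 -
        2 * Finset.univ.sup' Finset.univ_nonempty
          (fun i => |x i - ((round (x i) : ℤ) : ℝ)|)) ∧
    ∃ j : Fin 8,
      |x j - ((round (x j) : ℤ) : ℝ)| =
        Finset.univ.sup' Finset.univ_nonempty
          (fun i => |x i - ((round (x i) : ℤ) : ℝ)|) ∧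
      Function.update (fun i => round (x i)) j
          (if ((round (x j) : ℤ) : ℝ) ≤ x j then round (x j) + 1 else round (x j) - 1) ∈ D8 ∧
      ∑ i, (x i - ((Function.update (fun i => round (x i)) j
          (if ((round (x j) : ℤ) : ℝ) ≤ x j then round (x j) + 1 else round (x j) - 1)
            i : ℤ) : ℝ)) ^ 2 =
        ∑ i, (x i - ((round (x i) : ℤ) : ℝ)) ^ 2 + 1 -
          2 * Finset.univ.sup' Finset.univ_nonempty
            (fun i => |x i - ((round (x i) : ℤ) : ℝ)|) := by
  obtain ⟨j, -, hj⟩ := Finset.exists_mem_eq_sup' Finset.univ_nonempty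
    (fun i => |x i - ((round (x i) : ℤ) : ℝ)|)
  have hmem : Function.update (fun i => round (x i)) j
      (if ((round (x j) : ℤ) : ℝ) ≤ x j then round (x j) + 1 else round (x j) - 1) ∈ D8 := by
    have hodd : Odd (∑ i, round (x i)) := by
      rwa [← Int.not_even_iff_odd, even_iff_exists_two_mul]
    obtain ⟨k, hk⟩ := hodd
    have hsum := Fintype.sum_apply_update (fun _ n => n) (fun i => round (x i)) j
      (if ((round (x j) : ℤ) : ℝ) ≤ x j then round (x j) + 1 else round (x j) - 1)
    simp only [D8, Set.mem_ofPred_eq, hsum, hk]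
    split_ifs
    · exact ⟨k + 1, by ring⟩
    · exact ⟨k, by ring⟩
  have hval : ∑ i, (x i - ((Function.update (fun i => round (x i)) j
      (if ((round (x j) : ℤ) : ℝ) ≤ x j then round (x j) + 1 else round (x j) - 1)
        i : ℤ) : ℝ)) ^ 2 =
      ∑ i, (x i - ((round (x i) : ℤ) : ℝ)) ^ 2 + 1 -
        2 * Finset.univ.sup' Finset.univ_nonempty
          (fun i => |x i - ((round (x i) : ℤ) : ℝ)|) := by
    rw [hj, Fintype.sum_apply_update (fun i (n : ℤ) => (x i - (n : ℝ)) ^ 2), sq_sub_wrong_round]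
    ring
  refine ⟨⟨⟨_, hmem, hval.symm⟩, ?_⟩, j, hj.symm, hmem, hval⟩
  rintro _ ⟨z, hz, rfl⟩
  obtain ⟨i, hi⟩ : ∃ i, z i ≠ round (x i) := by
    by_contra! hall
    exact h (by simpa only [D8, Set.mem_ofPred_eq, hall] using hz)
  have hsup := Finset.le_sup' (fun i => |x i - ((round (x i) : ℤ) : ℝ)|) (Finset.mem_univ i)
  have hrest : ∑ l ∈ Finset.univ.erase i, (x l - (round (x l) : ℝ)) ^ 2 ≤
      ∑ l ∈ Finset.univ.erase i, (x l - (z l : ℝ)) ^ 2 :=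
    Finset.sum_le_sum fun l _ => sq_le_sq.mpr (round_le (x l) (z l))
  rw [← Finset.add_sum_erase _ (fun l => (x l - (z l : ℝ)) ^ 2) (Finset.mem_univ i),
    ← Finset.add_sum_erase _ (fun l => (x l - (round (x l) : ℝ)) ^ 2) (Finset.mem_univ i)]
  linarith [sq_sub_round_add_le hi]
end
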